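/- Let f, g : ℕ → ℤ be eventual quasi-polynomials, eventually positive, such that d(t) = gcd(f(t), g(t)) is an eventual quasi-polynomial of degree 0 (i.e., eventually periodic). Let H be a finite set of eventual quasi-polynomials, and for each t set S(t) = ⋃_{h ∈ H} ( h(t) + ⟨f(t), g(t)⟩ ). Let F(t) be the largest integer u such that u ≡ h(t) (mod d(t)) for some h ∈ H and u ∉ S(t). Then F is an eventual quasi-polynomial of degree at most max{deg(f) + deg(g), max_{h ∈ H} deg(h)}. -/

import Mathlib

/-- `f : ℕ → ℤ` is an eventual quasi-polynomial: for some period `m > 0` and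
component polynomials `c`, `f t = c (t % m) (t)` for all sufficiently large `t`. -/
def IsEQP (f : ℕ → ℤ) : Prop :=
  ∃ (N m : ℕ) (c : ℕ → Polynomial ℚ), 0 < m ∧
    ∀ t : ℕ, N ≤ t → (f t : ℚ) = (c (t % m)).eval (t : ℚ)

/-- `f` is an eventual quasi-polynomial of degree at most `k`. -/
def EQPDegLE (f : ℕ → ℤ) (k : ℕ) : Prop :=
  ∃ (N m : ℕ) (c : ℕ → Polynomial ℚ), 0 < m ∧ (∀ j, (c j).degree ≤ (k : ℕ)) ∧
    ∀ t : ℕ, N ≤ t → (f t : ℚ) = (c (t % m)).eval (t : ℚ)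

/-- The degree of an eventual quasi-polynomial: the least `k` such that `f` has an
eventual quasi-polynomial representation with all components of degree at most `k`. -/
noncomputable def EQPdeg (f : ℕ → ℤ) : ℕ := sInf {k | EQPDegLE f k}

/-- `f` is eventually positive. -/
def EventuallyPos (f : ℕ → ℤ) : Prop := ∃ N, ∀ t : ℕ, N ≤ t → 0 < f t

/-- `u` belongs to the numerical semigroup generated by `a 0, …, a (n-1)`. -/
def InSemigroup {n : ℕ} (a : Fin n → ℤ) (u : ℤ) : Prop :=
  ∃ p : Fin n → ℕ, u = ∑ i, (p i : ℤ) * a i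

/-- `u` belongs to the group generated by `a 0, …, a (n-1)`. -/
def InGroup {n : ℕ} (a : Fin n → ℤ) (u : ℤ) : Prop :=
  ∃ p : Fin n → ℤ, u = ∑ i, p i * a i

/-- `F` is the (generalized) Frobenius number of `a 0, …, a (n-1)`: the largest
element of the generated group that is not in the generated semigroup. -/
def IsFrobeniusNumber {n : ℕ} (a : Fin n → ℤ) (F : ℤ) : Prop :=
  IsGreatest {u : ℤ | InGroup a u ∧ ¬ InSemigroup a u} F

section

open Polynomial Filter

/-- `f` eventually agrees with a polynomial. -/
def EvPoly (f : ℕ → ℤ) : Prop :=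
  ∃ c : ℚ[X], ∀ᶠ s : ℕ in atTop, (f s : ℚ) = c.eval (s : ℚ)

/-- The restriction of `f` to every residue class modulo `m` is eventually polynomial. -/
def SplitsAt (f : ℕ → ℤ) (m : ℕ) : Prop :=
  ∀ r < m, EvPoly fun s => f (m * s + r)

theorem tendsto_progression {m : ℕ} (hm : 0 < m) (r : ℕ) :
    Tendsto (fun s : ℕ => m * s + r) atTop atTop :=
  tendsto_atTop_mono (fun s => (Nat.le_mul_of_pos_left s hm).trans (Nat.le_add_right _ r))
    tendsto_id

theorem EvPoly.comp_progression {f : ℕ → ℤ} (hf : EvPoly f) {m : ℕ} (hm : 0 < m) (r : ℕ) :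
    EvPoly fun s => f (m * s + r) := by
  obtain ⟨c, hc⟩ := hf
  refine ⟨c.comp (C (m : ℚ) * X + C (r : ℚ)), ?_⟩
  filter_upwards [(tendsto_progression hm r).eventually hc] with s hs
  rw [hs]
  simp

theorem SplitsAt.mul {f : ℕ → ℤ} {m : ℕ} (hf : SplitsAt f m) (hm : 0 < m) {n : ℕ} (hn : 0 < n) :
    SplitsAt f (m * n) := by
  intro r hr
  have h := (hf (r % m) (Nat.mod_lt _ hm)).comp_progression hn (r / m)
  convert h using 3 with s
  have := Nat.div_add_mod r m
  nlinarith

theorem isEQP_iff {f : ℕ → ℤ} : IsEQP f ↔ ∃ m, 0 < m ∧ SplitsAt f m := by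
  constructor
  · rintro ⟨N, m, c, hm, hc⟩
    refine ⟨m, hm, fun r hr => ⟨(c r).comp (C (m : ℚ) * X + C (r : ℚ)), ?_⟩⟩
    filter_upwards [(tendsto_progression hm r).eventually (eventually_ge_atTop N)] with s hs
    rw [hc _ hs]
    simp [Nat.mod_eq_of_lt hr]
  · rintro ⟨m, hm, h⟩
    choose! c hc using h
    have hall : ∀ᶠ s : ℕ in atTop, ∀ r ∈ Finset.range m,
        (f (m * s + r) : ℚ) = (c r).eval (s : ℚ) :=
      (Filter.eventually_all_finset _).2 fun r hr => hc r (Finset.mem_range.1 hr)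
    obtain ⟨N, hN⟩ := eventually_atTop.1 hall
    refine ⟨m * N, m, fun r => (c r).comp (C ((m : ℚ)⁻¹) * (X - C (r : ℚ))), hm, fun t ht => ?_⟩
    have hdiv : N ≤ t / m := (Nat.le_div_iff_mul_le hm).2 (by rwa [mul_comm])
    have := hN _ hdiv (t % m) (Finset.mem_range.2 (Nat.mod_lt _ hm))
    rw [Nat.div_add_mod] at this
    rw [this]
    have hm' : (m : ℚ) ≠ 0 := by exact_mod_cast hm.ne'
    have e : (t : ℚ) = m * (t / m : ℕ) + (t % m : ℕ) := by exact_mod_cast (Nat.div_add_mod t m).symm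
    have e2 : ((t / m : ℕ) : ℚ) = (m : ℚ)⁻¹ * ((t : ℚ) - (t % m : ℕ)) := by
      rw [e]; field_simp; simp
    rw [e2]
    simp

theorem EvPoly.isEQP {f : ℕ → ℤ} (hf : EvPoly f) : IsEQP f :=
  isEQP_iff.2 ⟨1, one_pos, fun r _ => hf.comp_progression one_pos r⟩

theorem IsEQP.exists_common {f g : ℕ → ℤ} (hf : IsEQP f) (hg : IsEQP g) :
    ∃ m, 0 < m ∧ SplitsAt f m ∧ SplitsAt g m := by
  obtain ⟨m, hm, hf⟩ := isEQP_iff.1 hf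
  obtain ⟨n, hn, hg⟩ := isEQP_iff.1 hg
  exact ⟨m * n, Nat.mul_pos hm hn, hf.mul hm hn, by rw [mul_comm]; exact hg.mul hn hm⟩

theorem isEQP_of_progressions {f : ℕ → ℤ} {m : ℕ} (hm : 0 < m)
    (h : ∀ r < m, IsEQP fun s => f (m * s + r)) : IsEQP f := by
  simp only [isEQP_iff] at h
  choose! n hn hs using h
  have hM : 0 < ∏ r ∈ Finset.range m, n r :=
    Finset.prod_pos fun r hr => hn r (Finset.mem_range.1 hr)
  refine isEQP_iff.2 ⟨m * ∏ r ∈ Finset.range m, n r, Nat.mul_pos hm hM, fun r hr => ?_⟩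
  have hr' := Nat.mod_lt r hm
  obtain ⟨k, hk⟩ := Finset.dvd_prod_of_mem n (Finset.mem_range.2 hr')
  have hk0 : 0 < k := Nat.pos_of_ne_zero (by rintro rfl; simp [hk] at hM)
  have hq : r / m < ∏ r ∈ Finset.range m, n r := Nat.div_lt_of_lt_mul hr
  have := (hs _ hr').mul (hn _ hr') hk0 (r / m) (by rwa [hk] at hq)
  rw [← hk] at this
  convert this using 3 with s
  have := Nat.div_add_mod r m
  nlinarith

theorem IsEQP.congr {f g : ℕ → ℤ} (hf : IsEQP f) (h : ∀ᶠ t in atTop, g t = f t) : IsEQP g := by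
  obtain ⟨m, hm, hs⟩ := isEQP_iff.1 hf
  refine isEQP_iff.2 ⟨m, hm, fun r hr => ?_⟩
  obtain ⟨c, hc⟩ := hs r hr
  refine ⟨c, ?_⟩
  filter_upwards [hc, (tendsto_progression hm r).eventually h] with s h1 h2
  rw [h2, h1]

theorem EvPoly.const (a : ℤ) : EvPoly fun _ => a := ⟨C (a : ℚ), by simp⟩

theorem isEQP_const (a : ℤ) : IsEQP fun _ => a := (EvPoly.const a).isEQP

theorem IsEQP.add {f g : ℕ → ℤ} (hf : IsEQP f) (hg : IsEQP g) : IsEQP fun t => f t + g t := by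
  obtain ⟨m, hm, h1, h2⟩ := hf.exists_common hg
  refine isEQP_iff.2 ⟨m, hm, fun r hr => ?_⟩
  obtain ⟨c, hc⟩ := h1 r hr
  obtain ⟨e, he⟩ := h2 r hr
  refine ⟨c + e, ?_⟩
  filter_upwards [hc, he] with s h1 h2
  simp [h1, h2]

theorem IsEQP.mul {f g : ℕ → ℤ} (hf : IsEQP f) (hg : IsEQP g) : IsEQP fun t => f t * g t := by
  obtain ⟨m, hm, h1, h2⟩ := hf.exists_common hg
  refine isEQP_iff.2 ⟨m, hm, fun r hr => ?_⟩
  obtain ⟨c, hc⟩ := h1 r hr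
  obtain ⟨e, he⟩ := h2 r hr
  refine ⟨c * e, ?_⟩
  filter_upwards [hc, he] with s h1 h2
  simp [h1, h2]

theorem IsEQP.sub {f g : ℕ → ℤ} (hf : IsEQP f) (hg : IsEQP g) : IsEQP fun t => f t - g t :=
  (hf.add ((isEQP_const (-1)).mul hg)).congr (.of_forall fun t => by ring)

/-- The indicator function of `P` is an eventual quasi-polynomial. -/
def EvPeriodic (P : ℕ → Prop) : Prop :=
  open Classical in IsEQP fun t => if P t then 1 else 0

theorem EvPeriodic.not {P : ℕ → Prop} (hP : EvPeriodic P) : EvPeriodic fun t => ¬ P t :=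
  IsEQP.congr ((isEQP_const 1).sub hP) (.of_forall fun t => by by_cases h : P t <;> simp [h])

theorem EvPeriodic.and {P Q : ℕ → Prop} (hP : EvPeriodic P) (hQ : EvPeriodic Q) :
    EvPeriodic fun t => P t ∧ Q t :=
  IsEQP.congr (IsEQP.mul hP hQ)
    (.of_forall fun t => by by_cases h : P t <;> by_cases h' : Q t <;> simp [h, h'])

theorem EvPeriodic.congr {P Q : ℕ → Prop} (hP : EvPeriodic P) (h : ∀ᶠ t in atTop, Q t ↔ P t) :
    EvPeriodic Q := by
  refine IsEQP.congr hP ?_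
  filter_upwards [h] with t ht
  by_cases hPt : P t <;> simp [ht, hPt]

theorem EvPeriodic.imp {P Q : ℕ → Prop} (hP : EvPeriodic P) (hQ : EvPeriodic Q) :
    EvPeriodic fun t => P t → Q t :=
  (hP.and hQ.not).not.congr (.of_forall fun t => by tauto)

theorem EvPeriodic.forall_mem {ι : Type*} (s : Finset ι) {P : ι → ℕ → Prop}
    (hP : ∀ i ∈ s, EvPeriodic (P i)) : EvPeriodic fun t => ∀ i ∈ s, P i t := by
  classical
  induction s using Finset.induction_on with
  | empty => exact IsEQP.congr (isEQP_const 1) (by simp)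
  | insert a s _ ih =>
    refine ((hP a (by simp)).and (ih fun i hi => hP i (by simp [hi]))).congr ?_
    simp

open Classical in
theorem IsEQP.ite {P : ℕ → Prop} (hP : EvPeriodic P) {f g : ℕ → ℤ} (hf : IsEQP f) (hg : IsEQP g) :
    IsEQP fun t => if P t then f t else g t :=
  IsEQP.congr ((IsEQP.mul hP hf).add (IsEQP.mul hP.not hg))
    (.of_forall fun t => by by_cases h : P t <;> simp [h])

theorem exists_isEQP_selection {ι : Type*} (s : Finset ι) {P : ι → ℕ → Prop} {c : ι → ℕ → ℤ}
    (hP : ∀ i ∈ s, EvPeriodic (P i)) (hc : ∀ i ∈ s, IsEQP (c i)) :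
    ∃ G, IsEQP G ∧ ∀ t, (∃ i ∈ s, P i t) → ∃ i ∈ s, P i t ∧ G t = c i t := by
  classical
  induction s using Finset.induction_on with
  | empty => exact ⟨_, isEQP_const 0, by simp⟩
  | insert a s _ ih =>
    obtain ⟨G, hG, h⟩ := ih (fun i hi => hP i (by simp [hi])) (fun i hi => hc i (by simp [hi]))
    refine ⟨_, IsEQP.ite (hP a (by simp)) (hc a (by simp)) hG, fun t ht => ?_⟩
    by_cases ha : P a t
    · exact ⟨a, by simp, ha, by simp [ha]⟩
    · obtain ⟨i, hi, hit⟩ := ht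
      have hi' : i ∈ s := (Finset.mem_insert.1 hi).resolve_left (by rintro rfl; exact ha hit)
      obtain ⟨j, hj, hjt, e⟩ := h t ⟨i, hi', hit⟩
      exact ⟨j, by simp [hj], hjt, by simp [ha, e]⟩

theorem tendsto_natCast_rat : Tendsto (fun s : ℕ => (s : ℚ)) atTop atTop :=
  tendsto_natCast_atTop_atTop

theorem Polynomial.eventually_nonneg_or_neg (c : ℚ[X]) :
    (∀ᶠ s : ℕ in atTop, 0 ≤ c.eval (s : ℚ)) ∨ ∀ᶠ s : ℕ in atTop, c.eval (s : ℚ) < 0 := by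
  rcases le_or_gt c.degree 0 with hd | hd
  · rw [eq_C_of_degree_le_zero hd]
    rcases le_or_gt 0 (c.coeff 0) with h | h <;> simp [h]
  · rcases le_total 0 c.leadingCoeff with h | h
    · exact .inl (tendsto_natCast_rat.eventually
        ((c.tendsto_atTop_of_leadingCoeff_nonneg hd h).eventually_ge_atTop 0))
    · exact .inr (tendsto_natCast_rat.eventually
        ((c.tendsto_atBot_of_leadingCoeff_nonpos hd h).eventually_lt_atBot 0))

theorem IsEQP.evPeriodic_nonneg {f : ℕ → ℤ} (hf : IsEQP f) : EvPeriodic fun t => 0 ≤ f t := by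
  obtain ⟨m, hm, hs⟩ := isEQP_iff.1 hf
  refine isEQP_of_progressions hm fun r hr => ?_
  obtain ⟨c, hc⟩ := hs r hr
  rcases c.eventually_nonneg_or_neg with h | h
  · refine (isEQP_const 1).congr ?_
    filter_upwards [hc, h] with s h1 h2
    rw [← h1] at h2
    simp [show 0 ≤ f (m * s + r) by exact_mod_cast h2]
  · refine (isEQP_const 0).congr ?_
    filter_upwards [hc, h] with s h1 h2
    rw [← h1] at h2
    simp [show f (m * s + r) < 0 by exact_mod_cast h2]

theorem IsEQP.evPeriodic_le {f g : ℕ → ℤ} (hf : IsEQP f) (hg : IsEQP g) :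
    EvPeriodic fun t => f t ≤ g t :=
  (hg.sub hf).evPeriodic_nonneg.congr (by simp)

theorem IsEQP.evPeriodic_eq {f g : ℕ → ℤ} (hf : IsEQP f) (hg : IsEQP g) :
    EvPeriodic fun t => f t = g t :=
  ((hf.evPeriodic_le hg).and (hg.evPeriodic_le hf)).congr (.of_forall fun _ => le_antisymm_iff)

theorem Polynomial.exists_int_multiple (c : ℚ[X]) :
    ∃ (K : ℤ) (A : ℤ[X]), 0 < K ∧ ∀ t : ℤ, ((A.eval t : ℤ) : ℚ) = K * c.eval (t : ℚ) := by
  induction c using Polynomial.induction_on' with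
  | add p q hp hq =>
    obtain ⟨K, A, hK, hA⟩ := hp
    obtain ⟨L, B, hL, hB⟩ := hq
    refine ⟨K * L, C L * A + C K * B, mul_pos hK hL, fun t => ?_⟩
    simp [hA, hB]
    ring
  | monomial n a =>
    refine ⟨a.den, monomial n a.num, by exact_mod_cast a.den_pos, fun t => ?_⟩
    have h : ((a.den : ℤ) : ℚ) * a = a.num := by exact_mod_cast a.den_mul_eq_num
    rw [eval_monomial, eval_monomial, ← mul_assoc, h]
    push_cast
    rfl

theorem IsEQP.ediv_const {f : ℕ → ℤ} (hf : IsEQP f) {M : ℤ} (hM : 0 < M) :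
    IsEQP fun t => f t / M := by
  obtain ⟨m, hm, hs⟩ := isEQP_iff.1 hf
  refine isEQP_of_progressions hm fun r hr => ?_
  obtain ⟨c, hc⟩ := hs r hr
  set φ : ℕ → ℤ := fun s => f (m * s + r)
  obtain ⟨K, A, hK, hA⟩ := c.exists_int_multiple
  lift K to ℕ using hK.le
  lift M to ℕ using hM.le
  have hKM : 0 < K * M := Nat.mul_pos (by exact_mod_cast hK) (by exact_mod_cast hM)
  refine isEQP_iff.2 ⟨K * M, hKM, fun i hi => ?_⟩
  have hφA : ∀ᶠ s in atTop, (K : ℤ) * φ s = A.eval (s : ℤ) := by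
    filter_upwards [hc] with s h
    have := hA s
    push_cast at this
    rw [← h] at this
    exact_mod_cast this.symm
  have hφA' := (tendsto_progression hKM i).eventually hφA
  obtain ⟨s₀, hs₀⟩ := hφA'.exists
  obtain ⟨e, he⟩ := EvPoly.comp_progression ⟨c, hc⟩ hKM i
  refine ⟨C ((M : ℚ)⁻¹) * (e - C ((φ (K * M * s₀ + i) % M : ℤ) : ℚ)), ?_⟩
  filter_upwards [hφA', he] with s h1 h2
  have hdvd : (M : ℤ) ∣ φ (K * M * s + i) - φ (K * M * s₀ + i) := by
    have h3 := A.sub_dvd_eval_sub ((K * M * s + i : ℕ) : ℤ) ((K * M * s₀ + i : ℕ) : ℤ)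
    rw [← h1, ← hs₀, ← mul_sub] at h3
    refine Int.dvd_of_mul_dvd_mul_left hK.ne' (Dvd.dvd.trans ⟨(s : ℤ) - s₀, ?_⟩ h3)
    push_cast
    ring
  have hmod := Int.emod_eq_emod_iff_emod_sub_eq_zero.2 (Int.emod_eq_zero_of_dvd hdvd)
  have h4 := Int.mul_ediv_add_emod (φ (K * M * s + i)) M
  rw [hmod] at h4
  have hM' : (M : ℚ) ≠ 0 := by exact_mod_cast hM.ne'
  simp only [eval_mul, eval_C, eval_sub, ← h2]
  rw [eq_inv_mul_iff_mul_eq₀ hM', eq_sub_iff_add_eq]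
  exact_mod_cast h4

theorem IsEQP.ediv {w b : ℕ → ℤ} (hw : IsEQP w) (hb : IsEQP b) (hpos : ∀ᶠ t in atTop, 0 < b t) :
    IsEQP fun t => w t / b t := by
  obtain ⟨m, hm, hw, hb⟩ := hw.exists_common hb
  refine isEQP_of_progressions hm fun r hr => ?_
  have hpos := (tendsto_progression hm r).eventually hpos
  obtain ⟨cw, hcw⟩ := hw r hr
  obtain ⟨cb, hcb⟩ := hb r hr
  set W : ℕ → ℤ := fun s => w (m * s + r)
  set B : ℕ → ℤ := fun s => b (m * s + r)
  have hcb0 : cb ≠ 0 := by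
    rintro rfl
    obtain ⟨s, h1, h2⟩ := (hpos.and hcb).exists
    have h3 : B s = 0 := by simpa using h2
    exact h1.ne' h3
  obtain ⟨K, A, hK, hA⟩ := (cw / cb).exists_int_multiple
  have hWp : IsEQP W := EvPoly.isEQP ⟨cw, hcw⟩
  have hBp : IsEQP B := EvPoly.isEQP ⟨cb, hcb⟩
  have hQ : IsEQP fun s : ℕ => A.eval (s : ℤ) :=
    EvPoly.isEQP ⟨C (K : ℚ) * (cw / cb), .of_forall fun s => by simpa using hA s⟩
  have hR : IsEQP fun s : ℕ => K * W s - A.eval (s : ℤ) * B s :=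
    ((isEQP_const K).mul hWp).sub (hQ.mul hBp)
  have hsmall : ∀ᶠ s : ℕ in atTop, |(C (K : ℚ) * (cw % cb)).eval (s : ℚ) / cb.eval (s : ℚ)| < 1 := by
    have hdeg : (C (K : ℚ) * (cw % cb)).degree < cb.degree := by
      rw [degree_C_mul (by exact_mod_cast hK.ne')]
      exact degree_mod_lt cw hcb0
    have := ((div_tendsto_atTop_zero_of_degree_lt _ _ hdeg).comp tendsto_natCast_rat).abs
    rw [abs_zero] at this
    exact this.eventually_lt_const one_pos
  refine ((hQ.add (IsEQP.ite hR.evPeriodic_nonneg (isEQP_const 0) (isEQP_const (-1)))).ediv_const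
    hK).congr ?_
  filter_upwards [hcw, hcb, hsmall, hpos] with s h1 h2 h3 h4
  change W s / B s = _
  change 0 < B s at h4
  set R := K * W s - A.eval (s : ℤ) * B s with hRdef
  have hRq : (R : ℚ) = (C (K : ℚ) * (cw % cb)).eval (s : ℚ) := by
    have e := congrArg (eval (s : ℚ)) (EuclideanDomain.div_add_mod cw cb)
    have hAs := hA s
    push_cast at hAs
    simp only [eval_add, eval_mul] at e
    rw [hRdef]
    push_cast
    rw [hAs, h1, h2, ← e]
    simp
    ring
  rw [← hRq, ← h2, abs_div, div_lt_one (by positivity)] at h3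
  have h5 : |R| < |B s| := by exact_mod_cast h3
  rw [abs_of_pos h4, abs_lt] at h5
  have hKW : K * W s = R + A.eval (s : ℤ) * B s := by rw [hRdef]; ring
  have hquot : K * W s / B s = A.eval (s : ℤ) + if 0 ≤ R then 0 else -1 := by
    rw [hKW, Int.add_mul_ediv_right _ _ h4.ne', add_comm]
    congr 1
    split_ifs with hR0
    · exact Int.ediv_eq_zero_of_lt hR0 h5.2
    · refine ((Int.ediv_emod_unique (r := R + B s) h4).2 ⟨by ring, by linarith, by linarith⟩).1
  calc W s / B s = K * W s / (K * B s) := (Int.mul_ediv_mul_of_pos _ _ hK).symm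
    _ = K * W s / B s / K := by rw [Int.ediv_ediv_of_nonneg h4.le, mul_comm (B s)]
    _ = _ := by rw [hquot]; congr

theorem IsEQP.emod {w b : ℕ → ℤ} (hw : IsEQP w) (hb : IsEQP b) (hpos : ∀ᶠ t in atTop, 0 < b t) :
    IsEQP fun t => w t % b t :=
  (hw.sub (hb.mul (hw.ediv hb hpos))).congr (.of_forall fun _ => Int.emod_def _ _)

theorem IsEQP.evPeriodic_dvd {w b : ℕ → ℤ} (hw : IsEQP w) (hb : IsEQP b)
    (hpos : ∀ᶠ t in atTop, 0 < b t) : EvPeriodic fun t => b t ∣ w t :=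
  ((hw.emod hb hpos).evPeriodic_eq (isEQP_const 0)).congr
    (.of_forall fun _ => Int.dvd_iff_emod_eq_zero)

theorem exists_isEQP_of_progressions {R : ℕ → ℤ → Prop} {m : ℕ} (hm : 0 < m)
    (h : ∀ r < m, ∃ p, IsEQP p ∧ ∀ᶠ s in atTop, R (m * s + r) (p s)) :
    ∃ p, IsEQP p ∧ ∀ᶠ t in atTop, R t (p t) := by
  choose! p hp hR using h
  refine ⟨fun t => p (t % m) (t / m), isEQP_of_progressions hm fun r hr => ?_, ?_⟩
  · refine (hp r hr).congr (.of_forall fun s => ?_)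
    simp [Nat.mod_eq_of_lt hr, Nat.mul_add_div hm, Nat.div_eq_of_lt hr]
  · have hall : ∀ᶠ s : ℕ in atTop, ∀ r ∈ Finset.range m, R (m * s + r) (p r s) :=
      (Filter.eventually_all_finset _).2 fun r hr => hR r (Finset.mem_range.1 hr)
    have hdiv : Tendsto (fun t : ℕ => t / m) atTop atTop := Nat.tendsto_div_const_atTop hm.ne'
    filter_upwards [hdiv.eventually hall] with t ht
    have := ht (t % m) (Finset.mem_range.2 (Nat.mod_lt _ hm))
    rwa [Nat.div_add_mod] at this

theorem isCoprime_of_gcd_bounded {f g : ℕ → ℤ} {cf cg : ℚ[X]}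
    (hf : ∀ᶠ s : ℕ in atTop, (f s : ℚ) = cf.eval (s : ℚ))
    (hg : ∀ᶠ s : ℕ in atTop, (g s : ℚ) = cg.eval (s : ℚ))
    (hfpos : ∀ᶠ s in atTop, 0 < f s) {B : ℤ}
    (hB : ∀ᶠ s in atTop, (Int.gcd (f s) (g s) : ℤ) ≤ B) : IsCoprime cf cg := by
  rw [← EuclideanDomain.gcd_isUnit_iff]
  set P := EuclideanDomain.gcd cf cg
  obtain ⟨f', hf'⟩ : P ∣ cf := EuclideanDomain.gcd_dvd_left _ _
  obtain ⟨g', hg'⟩ : P ∣ cg := EuclideanDomain.gcd_dvd_right _ _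
  have hP0 : P ≠ 0 := by
    intro h0
    obtain ⟨s, h1, h2⟩ := (hfpos.and hf).exists
    have : f s = 0 := by simpa [hf', h0] using h2
    omega
  by_contra hunit
  have hdeg : 0 < P.degree := degree_pos_of_ne_zero_of_nonunit hP0 hunit
  obtain ⟨K₁, A₁, hK₁, hA₁⟩ := P.exists_int_multiple
  obtain ⟨K₂, A₂, hK₂, hA₂⟩ := f'.exists_int_multiple
  obtain ⟨K₃, A₃, hK₃, hA₃⟩ := g'.exists_int_multiple
  set L := K₁ * K₂ * K₃
  have hL : 0 < L := by positivity
  have hbig := ((abs_tendsto_atTop P hdeg).comp tendsto_natCast_rat).eventually_gt_atTop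
    ((L * B : ℤ) : ℚ)
  obtain ⟨s, hfs, hgs, hpos, hBs, hPs⟩ :=
    (hf.and (hg.and (hfpos.and (hB.and hbig)))).exists
  have h₁ := hA₁ s
  have h₂ := hA₂ s
  have h₃ := hA₃ s
  push_cast at h₁ h₂ h₃
  have hdf : A₁.eval (s : ℤ) ∣ L * f s := by
    refine ⟨K₃ * A₂.eval (s : ℤ), ?_⟩
    have : ((L * f s : ℤ) : ℚ) = (A₁.eval (s : ℤ) * (K₃ * A₂.eval (s : ℤ)) : ℤ) := by
      push_cast
      rw [h₁, h₂, hfs, hf', eval_mul]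
      simp only [L]
      push_cast
      ring
    exact_mod_cast this
  have hdg : A₁.eval (s : ℤ) ∣ L * g s := by
    refine ⟨K₂ * A₃.eval (s : ℤ), ?_⟩
    have : ((L * g s : ℤ) : ℚ) = (A₁.eval (s : ℤ) * (K₂ * A₃.eval (s : ℤ)) : ℤ) := by
      push_cast
      rw [h₁, h₃, hgs, hg', eval_mul]
      simp only [L]
      push_cast
      ring
    exact_mod_cast this
  have hdvd : A₁.eval (s : ℤ) ∣ L * (Int.gcd (f s) (g s) : ℤ) := by
    rw [Int.gcd_eq_gcd_ab, mul_add, ← mul_assoc, ← mul_assoc]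
    exact dvd_add (hdf.mul_right _) (hdg.mul_right _)
  have hgpos : 0 < (Int.gcd (f s) (g s) : ℤ) := by
    exact_mod_cast Int.gcd_pos_of_ne_zero_left _ hpos.ne'
  have hle : |A₁.eval (s : ℤ)| ≤ L * B :=
    (Int.le_of_dvd (by positivity) ((abs_dvd _ _).2 hdvd)).trans
      (mul_le_mul_of_nonneg_left hBs hL.le)
  have hle' : |P.eval (s : ℚ)| ≤ ((L * B : ℤ) : ℚ) := by
    calc |P.eval (s : ℚ)| ≤ K₁ * |P.eval (s : ℚ)| :=
          le_mul_of_one_le_left (abs_nonneg _) (by exact_mod_cast hK₁)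
      _ = |((A₁.eval (s : ℤ) : ℤ) : ℚ)| := by
          rw [h₁, abs_mul, abs_of_pos (show (0 : ℚ) < K₁ by exact_mod_cast hK₁)]
      _ ≤ _ := by exact_mod_cast hle
  exact absurd hPs (not_lt.2 hle')

theorem exists_isEQP_bezout {f g : ℕ → ℤ} (hf : IsEQP f) (hg : IsEQP g)
    (hd : IsEQP fun t => (Int.gcd (f t) (g t) : ℤ)) (hfpos : ∀ᶠ t in atTop, 0 < f t)
    {B : ℤ} (hB : ∀ᶠ t in atTop, (Int.gcd (f t) (g t) : ℤ) ≤ B) :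
    ∃ p, IsEQP p ∧ ∀ᶠ t in atTop, g t ∣ p t * f t - (Int.gcd (f t) (g t) : ℤ) := by
  obtain ⟨m₁, hm₁, hf, hg⟩ := hf.exists_common hg
  obtain ⟨m₂, hm₂, hd⟩ := isEQP_iff.1 hd
  have hm : 0 < m₁ * m₂ := Nat.mul_pos hm₁ hm₂
  replace hf := hf.mul hm₁ hm₂
  replace hg := hg.mul hm₁ hm₂
  replace hd := hd.mul hm₂ hm₁
  rw [mul_comm] at hd
  generalize m₁ * m₂ = m at hm hf hg hd
  refine exists_isEQP_of_progressions
    (R := fun t p => g t ∣ p * f t - (Int.gcd (f t) (g t) : ℤ)) hm fun r hr => ?_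
  replace hfpos := (tendsto_progression hm r).eventually hfpos
  replace hB := (tendsto_progression hm r).eventually hB
  replace hf := hf r hr
  replace hg := hg r hr
  replace hd := hd r hr
  generalize hφ : (fun s => f (m * s + r)) = φ at hf
  generalize hψ : (fun s => g (m * s + r)) = ψ at hg
  have eφ : ∀ s, f (m * s + r) = φ s := fun s => congrFun hφ s
  have eψ : ∀ s, g (m * s + r) = ψ s := fun s => congrFun hψ s
  simp only [eφ, eψ] at hd hfpos hB ⊢
  obtain ⟨cf, hcf⟩ := hf
  obtain ⟨cg, hcg⟩ := hg
  obtain ⟨u, v, huv⟩ := isCoprime_of_gcd_bounded hcf hcg hfpos hB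
  obtain ⟨K, U, hK, hU⟩ := u.exists_int_multiple
  obtain ⟨L, V, hL, hV⟩ := v.exists_int_multiple
  set D := K * L
  have hD : 0 < D := mul_pos hK hL
  have hφE : IsEQP φ := EvPoly.isEQP ⟨cf, hcf⟩
  have hψE : IsEQP ψ := EvPoly.isEQP ⟨cg, hcg⟩
  have hUE : IsEQP fun s : ℕ => U.eval (s : ℤ) :=
    EvPoly.isEQP ⟨C (K : ℚ) * u, .of_forall fun s => by simpa using hU s⟩
  have hcomb : ∀ p q : ℤ, IsEQP fun s => p * φ s + q * ψ s - (Int.gcd (φ s) (ψ s) : ℤ) :=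
    fun p q => (((isEQP_const p).mul hφE).add ((isEQP_const q).mul hψE)).sub hd.isEQP
  obtain ⟨G, hG, hGs⟩ := exists_isEQP_selection (Finset.Ico 0 D ×ˢ Finset.Ico 0 D)
    (P := fun i s => D ∣ i.1 * φ s + i.2 * ψ s - (Int.gcd (φ s) (ψ s) : ℤ))
    (c := fun i s => i.1 - (i.1 * φ s + i.2 * ψ s - (Int.gcd (φ s) (ψ s) : ℤ)) / D *
      (L * U.eval (s : ℤ)))
    (fun i _ => (hcomb i.1 i.2).evPeriodic_dvd (isEQP_const D) (.of_forall fun _ => hD))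
    (fun i _ => (isEQP_const i.1).sub
      (((hcomb i.1 i.2).ediv_const hD).mul ((isEQP_const L).mul hUE)))
  refine ⟨G, hG, ?_⟩
  filter_upwards [hcf, hcg] with s hfs hgs
  have hUV : L * U.eval (s : ℤ) * φ s + K * V.eval (s : ℤ) * ψ s = D := by
    have e := congrArg (eval (s : ℚ)) huv
    simp only [eval_add, eval_mul, eval_one, ← hfs, ← hgs] at e
    have h₁ := hU s
    have h₂ := hV s
    push_cast at h₁ h₂
    have : ((L * U.eval (s : ℤ) * φ s + K * V.eval (s : ℤ) * ψ s : ℤ) : ℚ) = (D : ℤ) := by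
      simp only [D]
      push_cast
      rw [h₁, h₂]
      linear_combination (K : ℚ) * L * e
    exact_mod_cast this
  obtain ⟨⟨p, q⟩, -, ⟨k, hk⟩, hGp⟩ := hGs s
    ⟨(Int.gcdA (φ s) (ψ s) % D, Int.gcdB (φ s) (ψ s) % D),
      by simp [Int.emod_nonneg _ hD.ne', Int.emod_lt_of_pos _ hD],
      by
        refine ⟨-(Int.gcdA (φ s) (ψ s) / D * φ s + Int.gcdB (φ s) (ψ s) / D * ψ s), ?_⟩
        rw [Int.gcd_eq_gcd_ab, Int.emod_def, Int.emod_def]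
        ring⟩
  dsimp only at hk hGp
  rw [hk, Int.mul_ediv_cancel_left _ hD.ne'] at hGp
  refine ⟨k * (K * V.eval (s : ℤ)) - q, ?_⟩
  rw [hGp]
  linear_combination hk - k * hUV

theorem EQPDegLE.exists_bound {f : ℕ → ℤ} {k : ℕ} (hf : EQPDegLE f k) :
    ∃ M : ℚ, ∀ᶠ t : ℕ in atTop, |(f t : ℚ)| ≤ M * (t : ℚ) ^ k := by
  obtain ⟨N, m, c, hm, hdeg, hc⟩ := hf
  refine ⟨∑ j ∈ Finset.range m, ∑ i ∈ Finset.range (k + 1), |(c j).coeff i|, ?_⟩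
  filter_upwards [eventually_ge_atTop N, eventually_ge_atTop 1] with t hN h1
  have h1' : (1 : ℚ) ≤ t := by exact_mod_cast h1
  have hnat : (c (t % m)).natDegree < k + 1 :=
    Nat.lt_succ_of_le (natDegree_le_iff_degree_le.2 (hdeg _))
  calc |(f t : ℚ)| = |∑ i ∈ Finset.range (k + 1), (c (t % m)).coeff i * (t : ℚ) ^ i| := by
        rw [hc t hN, eval_eq_sum_range' hnat]
    _ ≤ ∑ i ∈ Finset.range (k + 1), |(c (t % m)).coeff i * (t : ℚ) ^ i| :=
        Finset.abs_sum_le_sum_abs _ _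
    _ ≤ ∑ i ∈ Finset.range (k + 1), |(c (t % m)).coeff i| * (t : ℚ) ^ k := by
        refine Finset.sum_le_sum fun i hi => ?_
        rw [abs_mul, abs_of_nonneg (by positivity : (0 : ℚ) ≤ (t : ℚ) ^ i)]
        exact mul_le_mul_of_nonneg_left
          (pow_le_pow_right₀ h1' (Nat.lt_succ_iff.1 (Finset.mem_range.1 hi))) (abs_nonneg _)
    _ = (∑ i ∈ Finset.range (k + 1), |(c (t % m)).coeff i|) * (t : ℚ) ^ k := by
        rw [Finset.sum_mul]
    _ ≤ _ := by
        refine mul_le_mul_of_nonneg_right ?_ (by positivity)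
        exact Finset.single_le_sum
          (f := fun j => ∑ i ∈ Finset.range (k + 1), |(c j).coeff i|)
          (fun j _ => Finset.sum_nonneg fun i _ => abs_nonneg _)
          (Finset.mem_range.2 (Nat.mod_lt t hm))

theorem IsEQP.degLE_of_bound {f : ℕ → ℤ} (hf : IsEQP f) {k : ℕ} {M : ℚ}
    (hM : ∀ᶠ t : ℕ in atTop, |(f t : ℚ)| ≤ M * (t : ℚ) ^ k) : EQPDegLE f k := by
  obtain ⟨N, m, c, hm, hc⟩ := hf
  refine ⟨N, m, fun j => if j < m then c j else 0, hm, fun j => ?_, fun t ht => ?_⟩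
  · beta_reduce
    split_ifs with hj
    · by_contra! hdeg
      rw [← degree_X_pow (R := ℚ) k] at hdeg
      have hprog := tendsto_progression hm j
      have hbig := ((abs_div_tendsto_atTop_atTop_of_degree_gt _ _ hdeg
        (pow_ne_zero k X_ne_zero)).comp (tendsto_natCast_rat.comp hprog)).eventually_gt_atTop M
      obtain ⟨s, h1, h2, h3, h4⟩ := (hbig.and ((hprog.eventually hM).and
        ((hprog.eventually (eventually_ge_atTop N)).and
          (hprog.eventually (eventually_gt_atTop 0))))).exists
      have hpos : (0 : ℚ) < ((m * s + j : ℕ) : ℚ) ^ k := pow_pos (by exact_mod_cast h4) k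
      rw [hc _ h3, Nat.mul_add_mod, Nat.mod_eq_of_lt hj] at h2
      simp only [Function.comp_apply, eval_pow, eval_X] at h1
      rw [abs_div, abs_of_pos hpos, lt_div_iff₀ hpos] at h1
      exact absurd h1 (not_lt.2 h2)
    · simp
  · simp only [hc t ht, if_pos (Nat.mod_lt t hm)]

theorem IsEQP.degLE_EQPdeg {f : ℕ → ℤ} (hf : IsEQP f) : EQPDegLE f (EQPdeg f) := by
  refine Nat.sInf_mem (s := {k | EQPDegLE f k}) ?_
  obtain ⟨N, m, c, hm, hc⟩ := hf
  refine ⟨(Finset.range m).sup fun j => (c j).natDegree, N, m,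
    fun j => if j < m then c j else 0, hm, fun j => ?_, fun t ht => ?_⟩
  · beta_reduce
    split_ifs with hj
    · exact natDegree_le_iff_degree_le.1
        (Finset.le_sup (f := fun j => (c j).natDegree) (Finset.mem_range.2 hj))
    · simp
  · simp only [hc t ht, if_pos (Nat.mod_lt t hm)]

end

/-- Membership in the numerical semigroup `⟨f, g⟩`, given an inverse `p` of `f / gcd(f, g)`
modulo `g / gcd(f, g)`. -/
theorem exists_nat_combination_iff {f g p w : ℤ} (hf : 0 < f) (hg : 0 < g)
    (hp : g ∣ p * f - (Int.gcd f g : ℤ)) :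
    (∃ x y : ℕ, w = x * f + y * g) ↔
      (Int.gcd f g : ℤ) ∣ w ∧
        (w / (Int.gcd f g : ℤ) * p) % (g / (Int.gcd f g : ℤ)) * f ≤ w := by
  have hd : 0 < (Int.gcd f g : ℤ) := by exact_mod_cast Int.gcd_pos_of_ne_zero_left _ hf.ne'
  obtain ⟨a, ha⟩ := Int.gcd_dvd_left f g
  obtain ⟨b, hb⟩ := Int.gcd_dvd_right f g
  generalize (Int.gcd f g : ℤ) = d at *
  obtain ⟨q, hq⟩ := hp
  have hb0 : 0 < b := by rw [hb] at hg; exact pos_of_mul_pos_right hg hd.le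
  have hpa : p * a - 1 = b * q := by
    refine mul_left_cancel₀ hd.ne' ?_
    rw [ha, hb] at hq
    linear_combination hq
  have hgd : g / d = b := by rw [hb, Int.mul_ediv_cancel_left _ hd.ne']
  rw [hgd]
  constructor
  · rintro ⟨x, y, rfl⟩
    have e : (x : ℤ) * f + y * g = d * (x * a + y * b) := by rw [ha, hb]; ring
    refine ⟨⟨_, e⟩, ?_⟩
    rw [e, Int.mul_ediv_cancel_left _ hd.ne', ← e]
    have e2 : (x * a + y * b) * p = x + b * (x * q + y * p) := by linear_combination x * hpa
    rw [e2, Int.add_mul_emod_self_left]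
    have h1 : (x : ℤ) % b ≤ x := by
      rw [Int.emod_def]
      nlinarith [Int.ediv_nonneg (Int.natCast_nonneg x) hb0.le]
    nlinarith [mul_nonneg (Int.natCast_nonneg y) hg.le]
  · rintro ⟨⟨k, rfl⟩, hle⟩
    rw [Int.mul_ediv_cancel_left _ hd.ne'] at hle
    have hx := Int.emod_nonneg (k * p) hb0.ne'
    have hdef := Int.emod_def (k * p) b
    generalize k * p % b = x at *
    have e : d * k - x * f = (k * p / b * a - k * q) * g := by
      rw [ha, hb, hdef]
      linear_combination -d * k * hpa
    have hy : 0 ≤ k * p / b * a - k * q := by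
      refine nonneg_of_mul_nonneg_left (b := g) ?_ hg
      linarith
    refine ⟨x.toNat, (k * p / b * a - k * q).toNat, ?_⟩
    rw [Int.toNat_of_nonneg hx, Int.toNat_of_nonneg hy, ← e]
    ring

/-- The corner between the generators `h` and `h'` of the staircase of a union of translates of
`⟨f, g⟩`: the only value that such a pair can contribute to the largest gap. -/
def corner (f g p h h' : ℤ) : ℤ :=
  h' + (((h - h') / (Int.gcd f g : ℤ) * p - 1) % (g / (Int.gcd f g : ℤ)) + 1) * f - f - g

/-- The translates `h t + ⟨f, g⟩` of the generators `h ∈ H` do not cover `u`. -/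
def IsGap (f g : ℤ) (H : Finset (ℕ → ℤ)) (t : ℕ) (u : ℤ) : Prop :=
  ¬ ∃ h ∈ H, ∃ x y : ℕ, u = h t + (x : ℤ) * f + (y : ℤ) * g

theorem exists_eq_corner {f g p : ℤ} (hf : 0 < f) (hg : 0 < g)
    (hp : g ∣ p * f - (Int.gcd f g : ℤ)) {H : Finset (ℕ → ℤ)} {t : ℕ} {F : ℤ}
    (hF : IsGreatest {u : ℤ | (∃ h ∈ H, (Int.gcd f g : ℤ) ∣ u - h t) ∧ IsGap f g H t u} F) :
    ∃ h ∈ H, ∃ h' ∈ H, (Int.gcd f g : ℤ) ∣ h t - h' t ∧ F = corner f g p (h t) (h' t) ∧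
      |F| ≤ |h' t| + f * g := by
  obtain ⟨⟨⟨h₀, hh₀, hmod⟩, hgap⟩, hmax⟩ := hF
  have hd : 0 < (Int.gcd f g : ℤ) := by exact_mod_cast Int.gcd_pos_of_ne_zero_left _ hf.ne'
  have hdf := Int.gcd_dvd_left f g
  have hdg := Int.gcd_dvd_right f g
  have hcover : ∀ v, 0 < v → (Int.gcd f g : ℤ) ∣ v →
      ∃ h ∈ H, ∃ x y : ℕ, F + v = h t + (x : ℤ) * f + (y : ℤ) * g := by
    intro v hv hdv
    by_contra hcon
    have := hmax ⟨⟨h₀, hh₀, by rw [add_sub_right_comm]; exact dvd_add hmod hdv⟩, hcon⟩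
    linarith
  obtain ⟨h, hh, x, y, hxy⟩ := hcover f hf hdf
  obtain ⟨h', hh', x', y', hxy'⟩ := hcover g hg hdg
  obtain rfl : x = 0 := by
    rcases x with _ | x
    · rfl
    · exact (hgap ⟨h, hh, x, y, by push_cast at hxy; linarith⟩).elim
  obtain rfl : y' = 0 := by
    rcases y' with _ | y'
    · rfl
    · exact (hgap ⟨h', hh', x', y', by push_cast at hxy'; linarith⟩).elim
  obtain ⟨a, ha⟩ := hdf
  obtain ⟨b, hb⟩ := hdg
  unfold corner
  generalize (Int.gcd f g : ℤ) = d at *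
  obtain ⟨q, hq⟩ := hp
  have ha0 : 0 < a := by rw [ha] at hf; exact pos_of_mul_pos_right hf hd.le
  have hb0 : 0 < b := by rw [hb] at hg; exact pos_of_mul_pos_right hg hd.le
  have hpa : p * a - 1 = b * q := by
    refine mul_left_cancel₀ hd.ne' ?_
    rw [ha, hb] at hq
    linear_combination hq
  have hgd : g / d = b := by rw [hb, Int.mul_ediv_cancel_left _ hd.ne']
  have hxb : (x' : ℤ) < b := by
    by_contra! hle
    refine hgap ⟨h', hh', (x' - b).toNat, (a - 1).toNat, ?_⟩
    rw [Int.toNat_of_nonneg (by linarith), Int.toNat_of_nonneg (by linarith)]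
    rw [ha, hb] at hxy' ⊢
    push_cast at hxy'
    linear_combination hxy'
  have hdiff : h t - h' t = d * ((x' + 1) * a - (y + 1) * b) := by
    push_cast at hxy hxy'
    have : h t - h' t = (x' + 1) * f - (y + 1) * g := by linear_combination hxy' - hxy
    rw [this, ha, hb]
    ring
  refine ⟨h, hh, h', hh', ⟨_, hdiff⟩, ?_, ?_⟩
  · rw [hdiff, hgd, Int.mul_ediv_cancel_left _ hd.ne']
    have e : ((x' + 1) * a - (y + 1) * b) * p - 1 =
        x' + b * ((x' + 1) * q - (y + 1) * p) := by linear_combination (x' + 1 : ℤ) * hpa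
    rw [e, Int.add_mul_emod_self_left, Int.emod_eq_of_lt (by positivity) hxb]
    push_cast at hxy'
    linear_combination hxy'
  · have hbg : b ≤ g := by rw [hb]; nlinarith
    have hF : F = h' t + (x' * f - g) := by
      push_cast at hxy'
      linear_combination hxy'
    rw [hF]
    refine (abs_add_le _ _).trans (add_le_add_right (abs_le.2 ⟨?_, ?_⟩) _)
    · nlinarith [mul_nonneg (Int.natCast_nonneg x') hf.le]
    · nlinarith

open Filter

theorem isEQP_of_isGreatest {ι : Type*} (s : Finset ι) {Q : ι → ℕ → Prop} {c : ι → ℕ → ℤ}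
    (hQ : ∀ i ∈ s, EvPeriodic (Q i)) (hc : ∀ i ∈ s, IsEQP (c i)) {F : ℕ → ℤ}
    (hF : ∀ᶠ t in atTop, IsGreatest {u | ∃ i ∈ s, Q i t ∧ u = c i t} (F t)) : IsEQP F := by
  obtain ⟨G, hG, h⟩ := exists_isEQP_selection s
    (P := fun i t => Q i t ∧ ∀ j ∈ s, Q j t → c j t ≤ c i t) (c := c)
    (fun i hi => (hQ i hi).and (EvPeriodic.forall_mem s fun j hj =>
      (hQ j hj).imp ((hc j hj).evPeriodic_le (hc i hi)))) hc
  refine hG.congr ?_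
  filter_upwards [hF] with t ht
  obtain ⟨⟨i, hi, hQi, hFi⟩, hmax⟩ := ht
  obtain ⟨j, hj, ⟨hQj, hjmax⟩, hGj⟩ := h t
    ⟨i, hi, hQi, fun j hj hQj => hFi ▸ hmax ⟨j, hj, hQj, rfl⟩⟩
  rw [hGj]
  exact le_antisymm (hFi ▸ hjmax i hi hQi) (hmax ⟨j, hj, hQj, rfl⟩)


/-- **Lemma (finish).** Let `f, g` be eventually positive eventual quasi-polynomials
such that `d(t) = gcd(f(t), g(t))` is an eventual quasi-polynomial of degree 0, let
`H` be a finite set of eventual quasi-polynomials, and let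
`S(t) = ⋃_{h ∈ H} (h(t) + ⟨f(t), g(t)⟩)`. Then the function `F` giving the largest
integer congruent to some `h(t)` mod `d(t)` that is not in `S(t)` is an eventual
quasi-polynomial of degree at most `max(deg f + deg g, max_{h ∈ H} deg h)`. -/
theorem eqp_finish (f g : ℕ → ℤ) (hf : IsEQP f) (hg : IsEQP g)
    (hfp : EventuallyPos f) (hgp : EventuallyPos g)
    (hd : EQPDegLE (fun t => (Int.gcd (f t) (g t) : ℤ)) 0)
    (H : Finset (ℕ → ℤ)) (hH : ∀ h ∈ H, IsEQP h)
    (F : ℕ → ℤ)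
    (hF : ∃ N, ∀ t : ℕ, N ≤ t →
      IsGreatest {u : ℤ |
        (∃ h ∈ H, ((Int.gcd (f t) (g t) : ℤ)) ∣ (u - h t)) ∧
        ¬ ∃ h ∈ H, ∃ x y : ℕ, u = h t + (x : ℤ) * f t + (y : ℤ) * g t} (F t)) :
    IsEQP F ∧ EQPdeg F ≤ max (EQPdeg f + EQPdeg g) (H.sup EQPdeg) := by
  have hfpos := eventually_atTop.2 hfp
  have hgpos := eventually_atTop.2 hgp
  obtain ⟨M, hM⟩ := hd.exists_bound
  have hdE : IsEQP fun t => (Int.gcd (f t) (g t) : ℤ) :=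
    let ⟨N, m, c, hm, _, hc⟩ := hd; ⟨N, m, c, hm, hc⟩
  have hdpos : ∀ᶠ t in atTop, 0 < (Int.gcd (f t) (g t) : ℤ) := hfpos.mono fun t ht => by
    exact_mod_cast Int.gcd_pos_of_ne_zero_left _ ht.ne'
  have hB : ∀ᶠ t in atTop, (Int.gcd (f t) (g t) : ℤ) ≤ ⌊M⌋ := hM.mono fun t ht =>
    Int.le_floor.2 ((le_abs_self _).trans (by simpa using ht))
  obtain ⟨p, hpE, hp⟩ := exists_isEQP_bezout hf hg hdE hfpos hB
  have hbE := hg.ediv hdE hdpos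
  have hbpos : ∀ᶠ t in atTop, 0 < g t / (Int.gcd (f t) (g t) : ℤ) := by
    filter_upwards [hgpos, hdpos] with t h1 h2
    exact Int.ediv_pos_of_pos_of_dvd h1 h2.le (Int.gcd_dvd_right _ _)
  have hcorner : ∀ h ∈ H, ∀ h' ∈ H, IsEQP fun t => corner (f t) (g t) (p t) (h t) (h' t) :=
    fun h hh h' hh' => (((hH h' hh').add (((((((hH h hh).sub (hH h' hh')).ediv hdE hdpos).mul
      hpE).sub (isEQP_const 1)).emod hbE hbpos).add (isEQP_const 1) |>.mul hf)).sub hf).sub hg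
  have hgapE : ∀ c, IsEQP c → EvPeriodic fun t => IsGap (f t) (g t) H t (c t) := by
    intro c hc
    refine (EvPeriodic.forall_mem H (P := fun h t => ¬ ((Int.gcd (f t) (g t) : ℤ) ∣ c t - h t ∧
      ((c t - h t) / (Int.gcd (f t) (g t) : ℤ) * p t) % (g t / (Int.gcd (f t) (g t) : ℤ)) * f t
        ≤ c t - h t)) fun h hh => ?_).congr ?_
    · have hch := hc.sub (hH h hh)
      exact ((hch.evPeriodic_dvd hdE hdpos).and
        (((((hch.ediv hdE hdpos).mul hpE).emod hbE hbpos).mul hf).evPeriodic_le hch)).not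
    · filter_upwards [hfpos, hgpos, hp] with t h1 h2 h3
      simp only [← exists_nat_combination_iff h1 h2 h3, IsGap, sub_eq_iff_eq_add', ← add_assoc]
      push Not
      rfl
  have hF' : ∀ᶠ t in atTop, IsGreatest {u : ℤ | (∃ h ∈ H, (Int.gcd (f t) (g t) : ℤ) ∣ u - h t) ∧
      IsGap (f t) (g t) H t u} (F t) := eventually_atTop.2 hF
  have hFE : IsEQP F := by
    refine isEQP_of_isGreatest (H ×ˢ H)
      (Q := fun i t => (Int.gcd (f t) (g t) : ℤ) ∣ i.1 t - i.2 t ∧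
        IsGap (f t) (g t) H t (corner (f t) (g t) (p t) (i.1 t) (i.2 t)))
      (c := fun i t => corner (f t) (g t) (p t) (i.1 t) (i.2 t)) (fun i hi => ?_)
      (fun i hi => ?_) ?_
    · obtain ⟨h1, h2⟩ := Finset.mem_product.1 hi
      exact (((hH _ h1).sub (hH _ h2)).evPeriodic_dvd hdE hdpos).and
        (hgapE _ (hcorner _ h1 _ h2))
    · obtain ⟨h1, h2⟩ := Finset.mem_product.1 hi
      exact hcorner _ h1 _ h2
    · filter_upwards [hfpos, hgpos, hp, hF'] with t h1 h2 h3 h4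
      constructor
      · obtain ⟨h, hh, h', hh', hdvd, hFc, -⟩ := exists_eq_corner h1 h2 h3 h4
        exact ⟨(h, h'), by simp [hh, hh'], ⟨hdvd, hFc ▸ h4.1.2⟩, hFc⟩
      · rintro u ⟨⟨h, h'⟩, hi, ⟨-, hgap⟩, rfl⟩
        refine h4.2 ⟨⟨h', (Finset.mem_product.1 hi).2, ?_⟩, hgap⟩
        have hdf := Int.gcd_dvd_left (f t) (g t)
        have hdg := Int.gcd_dvd_right (f t) (g t)
        simp only [corner]
        rw [sub_right_comm, sub_right_comm _ (f t), add_sub_cancel_left]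
        exact dvd_sub (dvd_sub (hdf.mul_left _) hdf) hdg
  refine ⟨hFE, Nat.sInf_le ?_⟩
  set k := max (EQPdeg f + EQPdeg g) (H.sup EQPdeg)
  obtain ⟨A, hA⟩ := hf.degLE_EQPdeg.exists_bound
  obtain ⟨B, hBg⟩ := hg.degLE_EQPdeg.exists_bound
  have hbounds : ∀ h ∈ H, ∃ C : ℚ, ∀ᶠ t : ℕ in atTop, |(h t : ℚ)| ≤ C * (t : ℚ) ^ EQPdeg h :=
    fun h hh => (hH h hh).degLE_EQPdeg.exists_bound
  choose! C hC using hbounds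
  refine hFE.degLE_of_bound (M := ∑ h ∈ H, |C h| + |A| * |B|) ?_
  filter_upwards [hfpos, hgpos, hp, hF', hA, hBg, (eventually_all_finset H).2 hC,
    eventually_ge_atTop 1] with t h1 h2 h3 h4 h5 h6 h7 h8
  obtain ⟨-, -, h, hh, -, -, hle⟩ := exists_eq_corner h1 h2 h3 h4
  have ht : (1 : ℚ) ≤ t := by exact_mod_cast h8
  have ht0 : (0 : ℚ) ≤ t := by positivity
  have hle' : |(F t : ℚ)| ≤ |(h t : ℚ)| + |(f t : ℚ)| * |(g t : ℚ)| := by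
    rw [← abs_of_pos h1, ← abs_of_pos h2] at hle
    exact_mod_cast hle
  have hfg : |(f t : ℚ)| * |(g t : ℚ)| ≤ |A| * |B| * (t : ℚ) ^ k := by
    calc |(f t : ℚ)| * |(g t : ℚ)|
        ≤ (|A| * (t : ℚ) ^ EQPdeg f) * (|B| * (t : ℚ) ^ EQPdeg g) := by
          gcongr
          · exact h5.trans (by gcongr; exact le_abs_self _)
          · exact h6.trans (by gcongr; exact le_abs_self _)
      _ = |A| * |B| * (t : ℚ) ^ (EQPdeg f + EQPdeg g) := by rw [pow_add]; ring
      _ ≤ _ := by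
          gcongr
          exact le_max_left _ _
  have hhk : |(h t : ℚ)| ≤ (∑ h ∈ H, |C h|) * (t : ℚ) ^ k := by
    refine (h7 h hh).trans (mul_le_mul ?_ (pow_le_pow_right₀ ht ?_) (by positivity)
      (Finset.sum_nonneg fun _ _ => abs_nonneg _))
    · exact (le_abs_self _).trans
        (Finset.single_le_sum (f := fun h => |C h|) (fun _ _ => abs_nonneg _) hh)
    · exact (Finset.le_sup hh).trans (le_max_right _ _)
  calc |(F t : ℚ)| ≤ _ := hle'
    _ ≤ _ := add_le_add hhk hfg
    _ = _ := by ring
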